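/- (Gradient dominance.) For every K ∈ S, f(K) − f(K_*) ≤ [λ_n(Y_*) / (4 λ₁(R + Bᵀ X_* B) λ₁(Σ)²)] · ‖∇f(K)‖_F², where ∇f(K) = 2(RK − BᵀX(K)(A−BK))Y(K). -/

import Mathlib

open Matrix

/-- `M` is Schur stable: spectral radius `ρ(M) < 1`. -/
def IsSchur {k : ℕ} (M : Matrix (Fin k) (Fin k) ℝ) : Prop :=
  ∀ μ ∈ spectrum ℂ (M.map (Complex.ofReal ·)), ‖μ‖ < 1

/-- The largest eigenvalue `λ_n` of a (symmetric) real matrix. -/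
noncomputable def eigMax {k : ℕ} (M : Matrix (Fin k) (Fin k) ℝ) : ℝ :=
  sSup (spectrum ℝ M)

/-- The smallest eigenvalue `λ₁` of a (symmetric) real matrix. -/
noncomputable def eigMin {k : ℕ} (M : Matrix (Fin k) (Fin k) ℝ) : ℝ :=
  sInf (spectrum ℝ M)

section Auxiliary

open Filter Topology

section PowersTendToZero

open scoped Matrix.Norms.Operator

lemma IsSchur.tendsto_pow {k : ℕ} [NeZero k] {M : Matrix (Fin k) (Fin k) ℝ} (hM : IsSchur M) :
    Tendsto (fun j : ℕ => M ^ j) atTop (𝓝 0) := by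
  set C : Matrix (Fin k) (Fin k) ℂ := M.map (Complex.ofReal ·)
  have hrad : spectralRadius ℂ C < (1 : NNReal) :=
    spectrum.spectralRadius_lt_of_forall_lt C fun z hz => by
      exact_mod_cast hM z hz
  obtain ⟨r, hr, hr1⟩ := ENNReal.lt_iff_exists_nnreal_btwn.1 hrad
  have hr1' : r < 1 := by exact_mod_cast hr1
  have hC0 : Tendsto (fun j : ℕ => C ^ j) atTop (𝓝 0) := by
    refine squeeze_zero_norm' ?_
      (tendsto_pow_atTop_nhds_zero_of_lt_one r.coe_nonneg (NNReal.coe_lt_one.2 hr1'))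
    filter_upwards [(spectrum.pow_nnnorm_pow_one_div_tendsto_nhds_spectralRadius C).eventually_lt_const
      hr, eventually_gt_atTop 0] with j hj hj0
    have hj' : (0 : ℝ) < j := by exact_mod_cast hj0
    have h := ENNReal.rpow_le_rpow hj.le hj'.le
    rw [← ENNReal.rpow_mul, one_div, inv_mul_cancel₀ hj'.ne', ENNReal.rpow_one,
      ENNReal.rpow_natCast] at h
    exact_mod_cast h
  have hpow : ∀ j : ℕ, C ^ j = (M ^ j).map (Complex.ofReal ·) := fun j =>
    (map_pow (Complex.ofRealHom.mapMatrix) M j).symm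
  refine tendsto_pi_nhds.2 fun a => tendsto_pi_nhds.2 fun b => ?_
  have hab := ((tendsto_pi_nhds.1 ((tendsto_pi_nhds.1 hC0) a)) b)
  have hre := (Complex.continuous_re.tendsto _).comp hab
  refine Tendsto.congr (fun j => ?_) hre
  simp [hpow]

end PowersTendToZero

lemma isSchur_of_lyapunov {k : ℕ} {M P : Matrix (Fin k) (Fin k) ℝ} (hP : P.PosSemidef)
    (hM : (P - Mᵀ * P * M).PosDef) : IsSchur M := by
  intro μ hμ
  rw [← Matrix.spectrum_toLin', ← Module.End.hasEigenvalue_iff_mem_spectrum] at hμ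
  obtain ⟨v, hv⟩ := hμ.exists_hasEigenvector
  have hmul : (M.map (Complex.ofReal ·)) *ᵥ v = μ • v := by
    simpa using hv.apply_eq_smul
  set a : Fin k → ℝ := fun i => (v i).re with ha
  set b : Fin k → ℝ := fun i => (v i).im with hb
  have hMa : M *ᵥ a = μ.re • a - μ.im • b := by
    ext i
    simpa [Matrix.mulVec, dotProduct, ha, hb] using congrArg Complex.re (congrFun hmul i)
  have hMb : M *ᵥ b = μ.im • a + μ.re • b := by
    ext i
    have h := congrArg Complex.im (congrFun hmul i)
    simp [Matrix.mulVec, dotProduct] at h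
    simp only [Matrix.mulVec, dotProduct, ha, hb, Pi.add_apply, Pi.smul_apply, smul_eq_mul, h]
    ring
  have hq : ∀ x, x ⬝ᵥ ((P - Mᵀ * P * M) *ᵥ x) = x ⬝ᵥ (P *ᵥ x) - (M *ᵥ x) ⬝ᵥ (P *ᵥ (M *ᵥ x)) := by
    intro x
    rw [Matrix.sub_mulVec, dotProduct_sub, ← Matrix.mulVec_mulVec, ← Matrix.mulVec_mulVec,
      Matrix.dotProduct_mulVec x Mᵀ, Matrix.vecMul_transpose]
  have hne : a ≠ 0 ∨ b ≠ 0 := by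
    by_contra! h
    refine hv.2 (funext fun i => Complex.ext ?_ ?_)
    · simpa using congrFun h.1 i
    · simpa using congrFun h.2 i
  have hpos : ∀ x, x ≠ 0 → 0 < x ⬝ᵥ ((P - Mᵀ * P * M) *ᵥ x) := fun x hx => by
    simpa using hM.dotProduct_mulVec_pos hx
  have hnn : ∀ x, 0 ≤ x ⬝ᵥ ((P - Mᵀ * P * M) *ᵥ x) := fun x => by
    simpa using hM.posSemidef.dotProduct_mulVec_nonneg x
  have hPa : 0 ≤ a ⬝ᵥ (P *ᵥ a) := by simpa using hP.dotProduct_mulVec_nonneg a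
  have hPb : 0 ≤ b ⬝ᵥ (P *ᵥ b) := by simpa using hP.dotProduct_mulVec_nonneg b
  have hsum : 0 < a ⬝ᵥ ((P - Mᵀ * P * M) *ᵥ a) + b ⬝ᵥ ((P - Mᵀ * P * M) *ᵥ b) := by
    rcases hne with h | h
    · linarith [hpos a h, hnn b]
    · linarith [hpos b h, hnn a]
  have key : a ⬝ᵥ ((P - Mᵀ * P * M) *ᵥ a) + b ⬝ᵥ ((P - Mᵀ * P * M) *ᵥ b)
      = (1 - (μ.re * μ.re + μ.im * μ.im)) * (a ⬝ᵥ (P *ᵥ a) + b ⬝ᵥ (P *ᵥ b)) := by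
    rw [hq, hq, hMa, hMb]
    simp only [Matrix.mulVec_add, Matrix.mulVec_sub, Matrix.mulVec_smul, dotProduct_add,
      add_dotProduct, sub_dotProduct, dotProduct_sub, smul_dotProduct, dotProduct_smul, smul_eq_mul]
    ring
  have h1 : μ.re * μ.re + μ.im * μ.im < 1 := by
    by_contra! h
    rw [key] at hsum
    nlinarith [mul_nonneg (sub_nonneg.2 h) (add_nonneg hPa hPb)]
  rw [← Complex.normSq_apply, Complex.normSq_eq_norm_sq] at h1
  nlinarith [norm_nonneg μ]

namespace Matrix

variable {k l : ℕ}

lemma PosSemidef.transpose_mul_mul_same {P : Matrix (Fin k) (Fin k) ℝ} (hP : P.PosSemidef)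
    (N : Matrix (Fin k) (Fin l) ℝ) : (Nᵀ * P * N).PosSemidef := by
  simpa using hP.conjTranspose_mul_mul_same N

lemma posSemidef_transpose_mul_self (N : Matrix (Fin k) (Fin l) ℝ) : (Nᵀ * N).PosSemidef := by
  simpa using posSemidef_conjTranspose_mul_self N

lemma PosSemidef.transpose_eq {P : Matrix (Fin k) (Fin k) ℝ} (hP : P.PosSemidef) : Pᵀ = P := by
  simpa using hP.isHermitian.eq

lemma posSemidef_of_tendsto {P : ℕ → Matrix (Fin k) (Fin k) ℝ} {Z : Matrix (Fin k) (Fin k) ℝ}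
    (hP : ∀ j, (P j).PosSemidef) (hZ : Tendsto P atTop (𝓝 Z)) : Z.PosSemidef := by
  refine .of_dotProduct_mulVec_nonneg ?_ fun x => ?_
  · have h : Tendsto (fun j => (P j)ᴴ) atTop (𝓝 Zᴴ) :=
      ((continuous_id.matrix_conjTranspose).tendsto Z).comp hZ
    simp only [fun j => (hP j).isHermitian.eq] at h
    exact tendsto_nhds_unique h hZ
  · have hc : Continuous fun W : Matrix (Fin k) (Fin k) ℝ => star x ⬝ᵥ (W *ᵥ x) := by fun_prop
    exact ge_of_tendsto' ((hc.tendsto Z).comp hZ) fun j => (hP j).dotProduct_mulVec_nonneg x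

/-- Solutions of a stable discrete Lyapunov equation with semidefinite right-hand side are
semidefinite. -/
lemma posSemidef_of_stein {M Z W : Matrix (Fin k) (Fin k) ℝ}
    (hM : Tendsto (fun j : ℕ => M ^ j) atTop (𝓝 0)) (hZ : Mᵀ * Z * M + W = Z)
    (hW : W.PosSemidef) : Z.PosSemidef := by
  have hstep : ∀ j : ℕ, (Z - (M ^ j)ᵀ * Z * M ^ j).PosSemidef := by
    intro j
    induction j with
    | zero => simpa using PosSemidef.zero
    | succ j ih =>
      have h : Z - (M ^ (j + 1))ᵀ * Z * M ^ (j + 1)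
          = Mᵀ * (Z - (M ^ j)ᵀ * Z * M ^ j) * M + W := by
        rw [pow_succ, transpose_mul]
        nth_rewrite 1 [← hZ]
        noncomm_ring
      rw [h]
      exact (ih.transpose_mul_mul_same M).add hW
  refine posSemidef_of_tendsto hstep ?_
  have hc : Continuous fun N : Matrix (Fin k) (Fin k) ℝ => Z - Nᵀ * Z * N := by fun_prop
  have h := (hc.tendsto 0).comp hM
  rwa [transpose_zero, Matrix.mul_zero, sub_zero] at h

open scoped MatrixOrder Matrix.Norms.L2Operator in
lemma trace_mul_nonneg {P N : Matrix (Fin k) (Fin k) ℝ} (hP : P.PosSemidef) (hN : N.PosSemidef) :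
    0 ≤ (P * N).trace := by
  obtain ⟨C, rfl⟩ : ∃ C : Matrix (Fin k) (Fin k) ℝ, P = Cᴴ * C :=
    CStarAlgebra.nonneg_iff_eq_star_mul_self.1 hP.nonneg
  rw [mul_assoc, trace_mul_comm]
  exact (hN.mul_mul_conjTranspose_same C).trace_nonneg

/-- The trace duality between a discrete Lyapunov equation and its adjoint. -/
lemma trace_mul_eq_of_stein {M Z W Y S : Matrix (Fin k) (Fin k) ℝ} (hZ : Mᵀ * Z * M + W = Z)
    (hY : M * Y * Mᵀ + S = Y) : (Z * S).trace = (W * Y).trace := by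
  have hS : S = Y - M * Y * Mᵀ := by rw [eq_sub_iff_add_eq, add_comm, hY]
  have hW : W = Z - Mᵀ * Z * M := by rw [eq_sub_iff_add_eq, add_comm, hZ]
  have h : (Z * (M * Y * Mᵀ)).trace = (Mᵀ * Z * M * Y).trace := by
    rw [← mul_assoc, trace_mul_comm]
    simp only [mul_assoc]
  rw [hS, hW, mul_sub, sub_mul, trace_sub, trace_sub, h]

lemma IsHermitian.posSemidef_sub_eigMin {P : Matrix (Fin k) (Fin k) ℝ} (hP : P.IsHermitian) :
    (P - eigMin P • 1).PosSemidef := by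
  rw [posSemidef_iff_isHermitian_and_spectrum_nonneg]
  refine ⟨hP.sub (isHermitian_one.smul (IsSelfAdjoint.all _)), ?_⟩
  rw [← Algebra.algebraMap_eq_smul_one, ← spectrum.sub_singleton_eq]
  rintro _ ⟨x, hx, _, rfl, rfl⟩
  exact sub_nonneg.2 (csInf_le P.finite_real_spectrum.bddBelow hx)

lemma IsHermitian.posSemidef_eigMax_sub {P : Matrix (Fin k) (Fin k) ℝ} (hP : P.IsHermitian) :
    (eigMax P • 1 - P).PosSemidef := by
  rw [posSemidef_iff_isHermitian_and_spectrum_nonneg]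
  refine ⟨(isHermitian_one.smul (IsSelfAdjoint.all _)).sub hP, ?_⟩
  rw [← Algebra.algebraMap_eq_smul_one, ← spectrum.singleton_sub_eq]
  rintro _ ⟨_, rfl, x, hx, rfl⟩
  exact sub_nonneg.2 (le_csSup P.finite_real_spectrum.bddAbove hx)

lemma PosDef.eigMin_pos [NeZero k] {P : Matrix (Fin k) (Fin k) ℝ} (hP : P.PosDef) :
    0 < eigMin P := by
  have hmem : eigMin P ∈ spectrum ℝ P := by
    refine Set.Nonempty.csInf_mem ?_ P.finite_real_spectrum
    rw [hP.isHermitian.spectrum_real_eq_range_eigenvalues]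
    exact Set.range_nonempty _
  rw [hP.isHermitian.spectrum_real_eq_range_eigenvalues] at hmem
  obtain ⟨i, hi⟩ := hmem
  exact hi ▸ hP.eigenvalues_pos i

lemma PosSemidef.eigMax_nonneg {P : Matrix (Fin k) (Fin k) ℝ} (hP : P.PosSemidef) :
    0 ≤ eigMax P :=
  Real.sSup_nonneg fun _ hx => (posSemidef_iff_isHermitian_and_spectrum_nonneg.1 hP).2 hx

end Matrix

section CostDifference

variable {n m : ℕ} {A Q : Matrix (Fin n) (Fin n) ℝ} {B : Matrix (Fin n) (Fin m) ℝ}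
  {R : Matrix (Fin m) (Fin m) ℝ}

/-- The equation satisfied by the value matrix `P` of the gain `K` when the gain is replaced by
`K - D`. -/
lemma lyapunov_perturb {P : Matrix (Fin n) (Fin n) ℝ} {K : Matrix (Fin m) (Fin n) ℝ}
    (hR : Rᵀ = R) (hP : Pᵀ = P)
    (h : (A - B * K)ᵀ * P * (A - B * K) + Kᵀ * R * K + Q = P) (D : Matrix (Fin m) (Fin n) ℝ) :
    (A - B * (K - D))ᵀ * P * (A - B * (K - D)) + ((K - D)ᵀ * R * (K - D) + Q
      + (Dᵀ * (R * K - Bᵀ * P * (A - B * K)) + (R * K - Bᵀ * P * (A - B * K))ᵀ * D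
        - Dᵀ * (R + Bᵀ * P * B) * D)) = P := by
  have hA : A - B * (K - D) = (A - B * K) + B * D := by rw [Matrix.mul_sub]; abel
  generalize A - B * K = F at *
  refine Eq.trans ?_ h
  rw [hA]
  simp only [transpose_add, transpose_sub, transpose_mul, transpose_transpose, hR, hP,
    Matrix.mul_add, Matrix.add_mul, Matrix.mul_sub, Matrix.sub_mul, Matrix.mul_assoc]
  abel

/-- The equation satisfied by the difference of the value matrices of two gains. -/
lemma lyapunov_difference {P P' : Matrix (Fin n) (Fin n) ℝ} {K K' : Matrix (Fin m) (Fin n) ℝ}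
    (hR : Rᵀ = R) (hP : Pᵀ = P)
    (h : (A - B * K)ᵀ * P * (A - B * K) + Kᵀ * R * K + Q = P)
    (h' : (A - B * K')ᵀ * P' * (A - B * K') + K'ᵀ * R * K' + Q = P') :
    (A - B * K')ᵀ * (P - P') * (A - B * K')
      + ((K - K')ᵀ * (R * K - Bᵀ * P * (A - B * K))
        + (R * K - Bᵀ * P * (A - B * K))ᵀ * (K - K')
        - (K - K')ᵀ * (R + Bᵀ * P * B) * (K - K')) = P - P' := by
  have hp := lyapunov_perturb hR hP h (K - K')
  rw [sub_sub_cancel] at hp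
  have hd := congrArg₂ (· - ·) hp h'
  refine Eq.trans ?_ hd
  rw [Matrix.mul_sub _ P, Matrix.sub_mul _ _ (A - B * K')]
  abel

end CostDifference

end Auxiliary

theorem stmt7 {n m : ℕ} (hn : 0 < n) (hm : 0 < m)
    (A : Matrix (Fin n) (Fin n) ℝ) (B : Matrix (Fin n) (Fin m) ℝ)
    (Q Sig : Matrix (Fin n) (Fin n) ℝ) (R : Matrix (Fin m) (Fin m) ℝ)
    (hQ : Q.PosDef) (hR : R.PosDef) (hSig : Sig.PosDef)
    (X : Matrix (Fin m) (Fin n) ℝ → Matrix (Fin n) (Fin n) ℝ)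
    (Y : Matrix (Fin m) (Fin n) ℝ → Matrix (Fin n) (Fin n) ℝ)
    (hX : ∀ K, IsSchur (A - B * K) →
      (A - B * K)ᵀ * X K * (A - B * K) + Kᵀ * R * K + Q = X K)
    (hY : ∀ K, IsSchur (A - B * K) →
      (A - B * K) * Y K * (A - B * K)ᵀ + Sig = Y K)
    -- `Kstar` is the global minimizer of `f` over `S`
    (Kstar : Matrix (Fin m) (Fin n) ℝ) (hKstar : IsSchur (A - B * Kstar))
    (hmin : ∀ K, IsSchur (A - B * K) →
      Matrix.trace (X Kstar * Sig) ≤ Matrix.trace (X K * Sig))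
    (K : Matrix (Fin m) (Fin n) ℝ) (hK : IsSchur (A - B * K)) :
    Matrix.trace (X K * Sig) - Matrix.trace (X Kstar * Sig)
      ≤ eigMax (Y Kstar) / (4 * eigMin (R + Bᵀ * X Kstar * B) * (eigMin Sig) ^ 2)
        * Matrix.trace
            (((2 : ℝ) • ((R * K - Bᵀ * X K * (A - B * K)) * Y K))ᵀ
              * ((2 : ℝ) • ((R * K - Bᵀ * X K * (A - B * K)) * Y K))) := by
  have : NeZero n := ⟨hn.ne'⟩
  have : NeZero m := ⟨hm.ne'⟩
  have hRt : Rᵀ = R := hR.posSemidef.transpose_eq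
  have hXpsd : ∀ K, IsSchur (A - B * K) → (X K).PosSemidef := fun K hK =>
    posSemidef_of_stein hK.tendsto_pow (by rw [← add_assoc]; exact hX K hK)
      ((hR.posSemidef.transpose_mul_mul_same K).add hQ.posSemidef)
  have hYpsd : ∀ K, IsSchur (A - B * K) → (Y K - Sig).PosSemidef ∧ (Y K).PosSemidef := by
    intro K hK
    have hY0 : (Y K).PosSemidef := by
      refine posSemidef_of_stein (M := (A - B * K)ᵀ) (W := Sig) ?_ (by simpa using hY K hK)
        hSig.posSemidef
      have h := ((continuous_id.matrix_transpose).tendsto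
        (0 : Matrix (Fin n) (Fin n) ℝ)).comp hK.tendsto_pow
      simpa [Function.comp_def, transpose_pow] using h
    refine ⟨?_, hY0⟩
    have h : Y K - Sig = (A - B * K) * Y K * (A - B * K)ᵀ := by
      rw [sub_eq_iff_eq_add]; exact (hY K hK).symm
    rw [h]
    simpa using hY0.transpose_mul_mul_same (A - B * K)ᵀ
  set s := eigMin Sig
  have hs : 0 < s := hSig.eigMin_pos
  have hYs : ∀ K, IsSchur (A - B * K) → (Y K - s • 1).PosSemidef := fun K hK => by
    simpa using (hYpsd K hK).1.add hSig.isHermitian.posSemidef_sub_eigMin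
  have hMpd : ∀ K, IsSchur (A - B * K) → (R + Bᵀ * X K * B).PosDef := fun K hK =>
    hR.add_posSemidef ((hXpsd K hK).transpose_mul_mul_same B)
  -- First-order optimality, by a policy improvement step.
  have hEstar : R * Kstar - Bᵀ * X Kstar * (A - B * Kstar) = 0 := by
    set E := R * Kstar - Bᵀ * X Kstar * (A - B * Kstar) with hE
    set N := R + Bᵀ * X Kstar * B with hN
    have hNpd : N.PosDef := hMpd Kstar hKstar
    have hpos : 0 < eigMax N + 1 := by linarith [hNpd.posSemidef.eigMax_nonneg]
    obtain ⟨t, ht, htN⟩ : ∃ t : ℝ, 0 < t ∧ ((1 : Matrix (Fin m) (Fin m) ℝ) - t • N).PosSemidef := by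
      refine ⟨(eigMax N + 1)⁻¹, inv_pos.2 hpos, ?_⟩
      have h : (1 : Matrix (Fin m) (Fin m) ℝ) - (eigMax N + 1)⁻¹ • N
          = (eigMax N + 1)⁻¹ • ((eigMax N • 1 - N) + 1) := by
        have h1 : (1 : Matrix (Fin m) (Fin m) ℝ)
            = (eigMax N + 1)⁻¹ • ((eigMax N + 1) • (1 : Matrix (Fin m) (Fin m) ℝ)) := by
          rw [smul_smul, inv_mul_cancel₀ hpos.ne', one_smul]
        nth_rewrite 1 [h1]
        rw [← smul_sub, add_smul, one_smul]
        congr 1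
        abel
      rw [h]
      exact (hNpd.isHermitian.posSemidef_eigMax_sub.add .one).smul (inv_pos.2 hpos).le
    have hp := lyapunov_perturb hRt (hXpsd _ hKstar).transpose_eq (hX _ hKstar) (t • E)
    rw [← hE, ← hN] at hp
    set W := (t • E)ᵀ * E + Eᵀ * (t • E) - (t • E)ᵀ * N * (t • E) with hW
    have hWt : (W - t • (Eᵀ * E)).PosSemidef := by
      have h : W - t • (Eᵀ * E) = t • (Eᵀ * (1 - t • N) * E) := by
        rw [hW]
        simp only [transpose_smul, Matrix.mul_sub, Matrix.sub_mul, Matrix.smul_mul,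
          Matrix.mul_smul, smul_sub, Matrix.mul_one]
        abel
      rw [h]
      exact (htN.transpose_mul_mul_same E).smul ht.le
    have hWpsd : W.PosSemidef := by
      simpa using hWt.add ((posSemidef_transpose_mul_self E).smul ht.le)
    set K' := Kstar - t • E with hK'
    have hK'S : IsSchur (A - B * K') := by
      refine isSchur_of_lyapunov (hXpsd _ hKstar) ?_
      have h : X Kstar - (A - B * K')ᵀ * X Kstar * (A - B * K') = Q + (K'ᵀ * R * K' + W) := by
        rw [sub_eq_iff_eq_add]
        nth_rewrite 1 [← hp]
        abel
      rw [h]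
      exact hQ.add_posSemidef ((hR.posSemidef.transpose_mul_mul_same K').add hWpsd)
    have hdiff : (A - B * K')ᵀ * (X Kstar - X K') * (A - B * K') + W = X Kstar - X K' := by
      have h := lyapunov_difference hRt (hXpsd _ hKstar).transpose_eq (hX _ hKstar) (hX _ hK'S)
      rwa [← hE, ← hN, show Kstar - K' = t • E by rw [hK', sub_sub_cancel], ← hW] at h
    have htr := trace_mul_eq_of_stein hdiff (hY _ hK'S)
    rw [Matrix.sub_mul, trace_sub] at htr
    have h1 := trace_mul_nonneg hWt (hYpsd _ hK'S).2
    have h2 := trace_mul_nonneg (posSemidef_transpose_mul_self E) (hYs _ hK'S)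
    simp only [Matrix.sub_mul, Matrix.mul_sub, Matrix.smul_mul, Matrix.mul_smul, trace_sub,
      trace_smul, smul_eq_mul, Matrix.mul_one] at h1 h2
    have h3 := (posSemidef_transpose_mul_self E).trace_nonneg
    have h4 : (Eᵀ * E).trace = 0 := by
      have := hmin _ hK'S
      have h5 : t * (s * (Eᵀ * E).trace) ≤ 0 := by nlinarith
      nlinarith [mul_pos ht hs]
    simpa using (trace_conjTranspose_mul_self_eq_zero_iff (A := E)).1 (by simpa using h4)
  have hXmono : (X K - X Kstar).PosSemidef := by
    have h := lyapunov_difference hRt (hXpsd _ hKstar).transpose_eq (hX _ hKstar) (hX _ hK)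
    rw [hEstar] at h
    refine posSemidef_of_stein hK.tendsto_pow (W := (Kstar - K)ᵀ * (R + Bᵀ * X Kstar * B)
      * (Kstar - K)) ?_ ((hMpd _ hKstar).posSemidef.transpose_mul_mul_same _)
    have h' := congrArg Neg.neg h
    rw [neg_sub] at h'
    nth_rewrite 2 [← h']
    rw [← neg_sub (X Kstar) (X K), Matrix.mul_neg, Matrix.neg_mul, Matrix.mul_zero,
      transpose_zero, Matrix.zero_mul]
    abel
  set E := R * K - Bᵀ * X K * (A - B * K) with hE
  set μ := eigMin (R + Bᵀ * X Kstar * B)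
  set L := eigMax (Y Kstar)
  have hμ : 0 < μ := (hMpd _ hKstar).eigMin_pos
  have hL : 0 ≤ L := (hYpsd _ hKstar).2.eigMax_nonneg
  have hMμ : (R + Bᵀ * X K * B - μ • 1).PosSemidef := by
    have h : R + Bᵀ * X K * B - μ • 1
        = (R + Bᵀ * X Kstar * B - μ • 1) + Bᵀ * (X K - X Kstar) * B := by
      rw [Matrix.mul_sub, Matrix.sub_mul]; abel
    rw [h]
    exact (hMpd _ hKstar).isHermitian.posSemidef_sub_eigMin.add (hXmono.transpose_mul_mul_same B)
  have htr := trace_mul_eq_of_stein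
    (lyapunov_difference hRt (hXpsd _ hK).transpose_eq (hX _ hK) (hX _ hKstar)) (hY _ hKstar)
  rw [← hE, Matrix.sub_mul, trace_sub] at htr
  set D := K - Kstar
  have hsq : (μ⁻¹ • (Eᵀ * E)
      - (Dᵀ * E + Eᵀ * D - Dᵀ * (R + Bᵀ * X K * B) * D)).PosSemidef := by
    have h : μ⁻¹ • (Eᵀ * E) - (Dᵀ * E + Eᵀ * D - Dᵀ * (R + Bᵀ * X K * B) * D)
        = μ • ((D - μ⁻¹ • E)ᵀ * (D - μ⁻¹ • E)) + Dᵀ * (R + Bᵀ * X K * B - μ • 1) * D := by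
      generalize R + Bᵀ * X K * B = N
      simp only [transpose_sub, transpose_smul, Matrix.mul_sub, Matrix.sub_mul, Matrix.smul_mul,
        Matrix.mul_smul, smul_sub, smul_smul, mul_inv_cancel₀ hμ.ne', one_smul,
        mul_inv_cancel_left₀ hμ.ne', Matrix.mul_one]
      abel
    rw [h]
    exact ((posSemidef_transpose_mul_self _).smul hμ.le).add (hMμ.transpose_mul_mul_same D)
  have h1 := trace_mul_nonneg hsq (hYpsd _ hKstar).2
  have h2 := trace_mul_nonneg (posSemidef_transpose_mul_self E)
    (hYpsd _ hKstar).2.isHermitian.posSemidef_eigMax_sub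
  rw [Matrix.sub_mul, trace_sub, ← htr, Matrix.smul_mul, trace_smul, smul_eq_mul] at h1
  rw [Matrix.mul_sub, trace_sub, Matrix.mul_smul, trace_smul, smul_eq_mul, Matrix.mul_one] at h2
  have hYsq : (Y K * Y K - (s ^ 2) • 1).PosSemidef := by
    have h : Y K * Y K - (s ^ 2) • 1
        = (Y K - s • 1)ᵀ * (Y K - s • 1) + (2 * s) • (Y K - s • 1) := by
      rw [(hYs K hK).transpose_eq]
      simp only [Matrix.mul_sub, Matrix.sub_mul, Matrix.smul_mul, Matrix.mul_smul, smul_sub,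
        smul_smul, Matrix.mul_one, Matrix.one_mul]
      module
    rw [h]
    exact (posSemidef_transpose_mul_self _).add ((hYs K hK).smul (by positivity))
  have h3 := trace_mul_nonneg (posSemidef_transpose_mul_self E) hYsq
  rw [Matrix.mul_sub, trace_sub, Matrix.mul_smul, trace_smul, smul_eq_mul, Matrix.mul_one] at h3
  have hG : (((2 : ℝ) • (E * Y K))ᵀ * ((2 : ℝ) • (E * Y K))).trace
      = 4 * (Eᵀ * E * (Y K * Y K)).trace := by
    have h : ((E * Y K)ᵀ * (E * Y K)).trace = (Eᵀ * E * (Y K * Y K)).trace := by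
      rw [transpose_mul, (hYpsd K hK).2.transpose_eq, Matrix.mul_assoc, trace_mul_comm]
      simp only [Matrix.mul_assoc]
    rw [transpose_smul, Matrix.smul_mul, Matrix.mul_smul, smul_smul, trace_smul, h]
    norm_num
  rw [hG]
  set G := (Eᵀ * E * (Y K * Y K)).trace
  set e := (Eᵀ * E).trace
  calc _ ≤ μ⁻¹ * (L * e) := by
        nlinarith [mul_nonneg (inv_pos.2 hμ).le h2]
    _ = L / (4 * μ * s ^ 2) * (4 * (s ^ 2 * e)) := by field_simp
    _ ≤ L / (4 * μ * s ^ 2) * (4 * G) := by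
        have h4 : s ^ 2 * e ≤ G := by linarith
        gcongr
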